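/- arXiv:2110.04371 — 2 statements merged into one kernel-verified Lean document; each statement's English description precedes it below -/
import Mathlib

section
/- Let N and f be natural numbers with N ≥ 3f + 1, let B ⊆ Fin N be a finset with |B| ≤ f, let S ⊆ Fin N be a finset with |S| ≥ N − f, and let v : Fin N → ℕ. Let E be the (f+1)-th largest value of the multiset {v(k) : k ∈ S} (counted with multiplicity), i.e., the entry at index f (0-based) of this multiset sorted in decreasing order. Then there exist p, q ∈ S \ B with v(p) ≤ E and E ≤ v(q). -/
theorem List.Pairwise.succ_le_countP_ge_getElem {α : Type*} [LinearOrder α] {l : List α}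
    (hl : l.Pairwise (· ≥ ·)) {i : ℕ} (hi : i < l.length) :
    i + 1 ≤ l.countP (l[i] ≤ ·) := by
  have hall : (l.take (i + 1)).countP (l[i] ≤ ·) = (l.take (i + 1)).length := by
    rw [List.countP_eq_length]
    intro a ha
    obtain ⟨j, hj, rfl⟩ := List.mem_take_iff_getElem.mp ha
    simpa using hl.rel_get_of_le (a := ⟨j, by omega⟩) (b := ⟨i, hi⟩)
      (Fin.mk_le_mk.mpr (by omega))
  have hle := (List.take_sublist (i + 1) l).countP_le (p := (l[i] ≤ ·))
  rw [hall, List.length_take] at hle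
  omega

theorem List.Pairwise.length_sub_le_countP_le_getElem {α : Type*} [LinearOrder α] {l : List α}
    (hl : l.Pairwise (· ≥ ·)) {i : ℕ} (hi : i < l.length) :
    l.length - i ≤ l.countP (· ≤ l[i]) := by
  have hall : (l.drop i).countP (· ≤ l[i]) = (l.drop i).length := by
    rw [List.countP_eq_length]
    intro a ha
    obtain ⟨j, hj, rfl⟩ := List.mem_drop_iff_getElem.mp ha
    simpa using hl.rel_get_of_le (a := ⟨i, hi⟩) (b := ⟨i + j, by omega⟩)
      (Fin.mk_le_mk.mpr (by omega))
  have hle := (List.drop_sublist i l).countP_le (p := (· ≤ l[i]))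
  rwa [hall, List.length_drop] at hle

theorem Finset.countP_sort_map_val {ι α : Type*} [LinearOrder α] (s : Finset ι) (v : ι → α)
    (p : α → Prop) [DecidablePred p] :
    ((s.val.map v).sort (· ≥ ·)).countP p = (s.filter (fun k => p (v k))).card := by
  rw [← Multiset.coe_countP, Multiset.sort_eq, Multiset.countP_map]
  rfl

theorem Finset.exists_mem_sdiff_of_card_lt_card_filter {ι : Type*} [DecidableEq ι]
    {s t : Finset ι} {p : ι → Prop} [DecidablePred p] (h : t.card < (s.filter p).card) :
    ∃ k ∈ s \ t, p k := by
  obtain ⟨k, hk, hkt⟩ := Finset.exists_mem_notMem_of_card_lt_card h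
  rw [Finset.mem_filter] at hk
  exact ⟨k, Finset.mem_sdiff.mpr ⟨hk.1, hkt⟩, hk.2⟩

/-- Combinatorial core of Lemma `correct-estimation` of DispersedLedger's
inter-node linking: with `N ≥ 3f + 1` servers, at most `f` of them Byzantine
(the set `B`), a committed set `S` of at least `N - f` servers, and reported
observations `v`, the `(f+1)`-th largest value `E` of the multiset
`{v k : k ∈ S}` (the entry at 0-based index `f` of this multiset sorted in
decreasing order) is both lower- and upper-bounded by the observation of a
correct member of `S`. -/
theorem correct_estimation_bounds
    (N f : ℕ) (hN : N ≥ 3 * f + 1)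
    (B S : Finset (Fin N))
    (hB : B.card ≤ f)
    (hS : S.card ≥ N - f)
    (v : Fin N → ℕ)
    (E : ℕ)
    (hE : E = ((S.val.map v).sort (· ≥ ·)).getD f 0) :
    ∃ p ∈ S \ B, ∃ q ∈ S \ B, v p ≤ E ∧ E ≤ v q := by
  have hsorted := (S.val.map v).pairwise_sort (· ≥ ·)
  have hlen : ((S.val.map v).sort (· ≥ ·)).length = S.card := by simp
  have hf : f < ((S.val.map v).sort (· ≥ ·)).length := by omega
  rw [List.getD_eq_getElem _ _ hf] at hE
  have hge := hsorted.succ_le_countP_ge_getElem hf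
  have hle := hsorted.length_sub_le_countP_le_getElem hf
  rw [← hE, Finset.countP_sort_map_val S v (E ≤ ·)] at hge
  rw [← hE, hlen, Finset.countP_sort_map_val S v (· ≤ E)] at hle
  obtain ⟨p, hp, hpE⟩ := Finset.exists_mem_sdiff_of_card_lt_card_filter
    (show B.card < (S.filter (fun k => v k ≤ E)).card by omega)
  obtain ⟨q, hq, hqE⟩ := Finset.exists_mem_sdiff_of_card_lt_card_filter
    (show B.card < (S.filter (fun k => E ≤ v k)).card by omega)
  exact ⟨p, hp, q, hq, hpE, hqE⟩
end

section
/- Let F be a field, let N and k be natural numbers with 1 ≤ k ≤ N, let x : Fin N → F be injective, and let c : Fin N → F. For each finset D ⊆ Fin N with |D| = k, let p_D be the unique polynomial of degree less than k interpolating the points (x(i), c(i)) for i ∈ D (Lagrange interpolation). Then exactly one of the following holds: (1) for all finsets D₁, D₂ ⊆ Fin N with |D₁| = |D₂| = k, p_{D₁} = p_{D₂}; or (2) for every finset D ⊆ Fin N with |D| = k, there exists i : Fin N with p_D.eval(x(i)) ≠ c(i). -/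
/-- If decoding from `D` reproduces every chunk, then every subset of the same size decodes to the
same polynomial. -/
theorem Lagrange.interpolate_eq_of_forall_eval_eq {F ι : Type*} [Field F] [DecidableEq ι]
    {x c : ι → F} (hx : Function.Injective x) {D E : Finset ι} (hcard : D.card = E.card)
    (h : ∀ i, (Lagrange.interpolate D x c).eval (x i) = c i) :
    Lagrange.interpolate D x c = Lagrange.interpolate E x c :=
  Lagrange.eq_interpolate_of_eval_eq c hx.injOn
    (hcard ▸ Lagrange.degree_interpolate_lt c hx.injOn) fun i _ => h i

/-- If all subsets of a given positive size decode to the same polynomial, that polynomial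
reproduces every chunk. -/
theorem Lagrange.eval_interpolate_eq_of_forall_interpolate_eq {F ι : Type*} [Field F]
    [Fintype ι] [DecidableEq ι] {x c : ι → F} (hx : Function.Injective x) {D : Finset ι}
    (hD : 1 ≤ D.card)
    (h : ∀ E : Finset ι, E.card = D.card →
      Lagrange.interpolate D x c = Lagrange.interpolate E x c) (i : ι) :
    (Lagrange.interpolate D x c).eval (x i) = c i := by
  obtain ⟨E, hiE, -, hE⟩ := Finset.exists_subsuperset_card_eq (Finset.subset_univ {i})
    (by simpa using hD) (Finset.card_le_univ D)
  rw [h E hE]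
  exact Lagrange.eval_interpolate_at_node c hx.injOn (Finset.singleton_subset_iff.mp hiE)

/-- Lemma `avid-root-summary` of AVID-M for a Reed–Solomon `(k, N)` code:
chunks are values `c i` at distinct evaluation points `x i`, and decoding
from a size-`k` subset `D` is Lagrange interpolation `p_D`. Exactly one of
the following holds: (1) all size-`k` subsets decode to the same polynomial;
or (2) every size-`k` subset decodes to a polynomial whose re-encoding
disagrees with `c` at some position. -/
theorem avid_root_summary
    (F : Type*) [Field F]
    (N k : ℕ) (hk : 1 ≤ k) (hkN : k ≤ N)
    (x : Fin N → F) (hx : Function.Injective x)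
    (c : Fin N → F) :
    Xor'
      (∀ D₁ D₂ : Finset (Fin N), D₁.card = k → D₂.card = k →
        Lagrange.interpolate D₁ x c = Lagrange.interpolate D₂ x c)
      (∀ D : Finset (Fin N), D.card = k →
        ∃ i : Fin N, (Lagrange.interpolate D x c).eval (x i) ≠ c i) := by
  by_cases hB : ∀ D : Finset (Fin N), D.card = k →
      ∃ i : Fin N, (Lagrange.interpolate D x c).eval (x i) ≠ c i
  · refine Or.inr ⟨hB, fun hA => ?_⟩
    obtain ⟨D, -, hD⟩ := Finset.exists_subset_card_eq
      (s := (Finset.univ : Finset (Fin N))) (n := k) (by simpa using hkN)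
    obtain ⟨i, hi⟩ := hB D hD
    exact hi (Lagrange.eval_interpolate_eq_of_forall_interpolate_eq hx (hk.trans_eq hD.symm)
      (fun E hE => hA D E hD (hE.trans hD)) i)
  · refine Or.inl ⟨fun D₁ D₂ h₁ h₂ => ?_, hB⟩
    push Not at hB
    obtain ⟨D, hD, h⟩ := hB
    rw [← Lagrange.interpolate_eq_of_forall_eval_eq hx (hD.trans h₁.symm) h,
      ← Lagrange.interpolate_eq_of_forall_eval_eq hx (hD.trans h₂.symm) h]
end
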